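/- Let K be a field, r ≥ 1, and let R be a commutative K-algebra with a multi-filtered decomposition (R_λ)_{λ∈ℕ^r}. With \tilde R := Σ_{λ∈ℕ^r} t^λ ⊗ R_{≤λ} ⊆ K[t_1,…,t_r] ⊗_K R and 𝔪_0 := (t_1,…,t_r) the homogeneous maximal ideal of K[t_1,…,t_r], the quotient \tilde R / 𝔪_0 \tilde R is isomorphic as a K-algebra to the associated graded algebra gr R. -/

import Mathlib

open TensorProduct

set_option synthInstance.maxHeartbeats 1000000
set_option maxHeartbeats 1000000

namespace MultiFiltered

open MvPolynomial

variable {K : Type*} [Field K] {r : ℕ} {R : Type*} [CommRing R] [Algebra K R]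

/-- The monomial `t^λ`. -/
noncomputable def tpow (K : Type*) [Field K] {r : ℕ} (lam : Fin r → ℕ) :
    MvPolynomial (Fin r) K :=
  ∏ i, X i ^ lam i

lemma tpow_add (lam mu : Fin r → ℕ) : tpow K (lam + mu) = tpow K lam * tpow K mu := by
  simp [tpow, pow_add, Finset.prod_mul_distrib]

lemma tpow_zero : tpow K (0 : Fin r → ℕ) = 1 := by simp [tpow]

lemma tpow_single (i : Fin r) : tpow K (Pi.single i 1) = X i := by
  rw [tpow, Finset.prod_eq_single i] <;> simp +contextual

lemma tpow_eq_monomial (lam : Fin r → ℕ) :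
    tpow K lam = monomial (Finsupp.equivFunOnFinite.symm lam) 1 := by
  rw [tpow, monomial_eq, map_one, one_mul, Finsupp.prod_fintype _ _ (by simp)]
  rfl

lemma tpow_mem_span_X {lam : Fin r → ℕ} (h : lam ≠ 0) :
    tpow K lam ∈ Ideal.span (Set.range (X : Fin r → MvPolynomial (Fin r) K)) := by
  obtain ⟨i, hi⟩ := Function.ne_iff.mp h
  exact Ideal.mem_of_dvd _ ((dvd_pow_self _ hi).trans (Finset.dvd_prod_of_mem _ (Finset.mem_univ i)))
    (Ideal.subset_span ⟨i, rfl⟩)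

/-- The homogeneous generators `t^λ ⊗ x`, `x ∈ R_μ`, `μ ≤ λ`, of the Rees-type algebra. -/
def reesGenerators (ℛ : (Fin r → ℕ) → Submodule K R) : Set (MvPolynomial (Fin r) K ⊗[K] R) :=
  {z | ∃ lam mu, mu ≤ lam ∧ ∃ x ∈ ℛ mu, tpow K lam ⊗ₜ[K] x = z}

lemma iSup_map_eq_span_reesGenerators (ℛ : (Fin r → ℕ) → Submodule K R) :
    (⨆ lam : Fin r → ℕ, Submodule.map
      (TensorProduct.mk K (MvPolynomial (Fin r) K) R (∏ i, X i ^ lam i)) (⨆ mu ≤ lam, ℛ mu)) =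
    Submodule.span K (reesGenerators ℛ) := by
  apply le_antisymm
  · simp only [Submodule.map_iSup, iSup_le_iff]
    rintro lam mu hle _ ⟨x, hx, rfl⟩
    exact Submodule.subset_span ⟨lam, mu, hle, x, hx, rfl⟩
  · rw [Submodule.span_le]
    rintro _ ⟨lam, mu, hle, x, hx, rfl⟩
    exact Submodule.mem_iSup_of_mem lam
      ⟨x, Submodule.mem_iSup_of_mem mu (Submodule.mem_iSup_of_mem hle hx), rfl⟩

section Projection

variable (ℛ : (Fin r → ℕ) → Submodule K R) [DirectSum.Decomposition ℛ]

/-- The projection of `R` onto the component `R_λ`. -/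
noncomputable def proj (lam : Fin r → ℕ) : R →ₗ[K] ℛ lam :=
  DirectSum.component K _ (fun mu => ℛ mu) lam ∘ₗ (DirectSum.decomposeLinearEquiv ℛ).toLinearMap

lemma proj_of_mem {lam : Fin r → ℕ} {x : R} (hx : x ∈ ℛ lam) : proj ℛ lam x = ⟨x, hx⟩ :=
  Subtype.ext (DirectSum.decompose_of_mem_same ℛ hx)

lemma proj_of_mem_ne {lam mu : Fin r → ℕ} {x : R} (hx : x ∈ ℛ mu) (h : mu ≠ lam) :
    proj ℛ lam x = 0 :=
  Subtype.ext (DirectSum.decompose_of_mem_ne ℛ hx h)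

lemma proj_of_mem_iSup {lam kap : Fin r → ℕ} {x : R} (hx : x ∈ ⨆ nu ≤ kap, ℛ nu)
    (h : ¬ lam ≤ kap) : proj ℛ lam x = 0 := by
  have hle : (⨆ nu ≤ kap, ℛ nu) ≤ LinearMap.ker (proj ℛ lam) :=
    iSup₂_le fun nu hnu y hy => proj_of_mem_ne ℛ hy fun e => h (e ▸ hnu)
  exact hle hx

lemma sub_proj_mem (lam : Fin r → ℕ) (x : R) :
    x - proj ℛ lam x ∈ ⨆ nu ∈ {nu : Fin r → ℕ | nu ≠ lam}, ℛ nu := by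
  induction x using DirectSum.Decomposition.inductionOn ℛ with
  | zero => simp
  | @homogeneous mu m =>
    by_cases h : mu = lam
    · subst h
      simp [proj_of_mem ℛ m.2]
    · rw [proj_of_mem_ne ℛ m.2 h]
      simpa using Submodule.mem_iSup_of_mem mu (Submodule.mem_iSup_of_mem h m.2)
  | add x y hx hy =>
    rw [map_add, Submodule.coe_add, add_sub_add_comm]
    exact add_mem hx hy

variable {S : Type*} [CommRing S] [Algebra K S] (ψ : ∀ lam, ℛ lam →ₗ[K] S)

/-- The linear map `t^λ ⊗ x ↦ ψ_λ (π_λ x)`. -/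
noncomputable def symbolMap : MvPolynomial (Fin r) K ⊗[K] R →ₗ[K] S :=
  TensorProduct.lift ((basisMonomials (Fin r) K).constr K fun s => ψ s ∘ₗ proj ℛ s)

lemma symbolMap_tmul (lam : Fin r → ℕ) (x : R) :
    symbolMap ℛ ψ (tpow K lam ⊗ₜ x) = ψ lam (proj ℛ lam x) := by
  have h : tpow K lam = basisMonomials (Fin r) K (Finsupp.equivFunOnFinite.symm lam) := by
    rw [tpow_eq_monomial, coe_basisMonomials]
  rw [symbolMap, TensorProduct.lift.tmul, h, Module.Basis.constr_basis]
  rfl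

lemma symbolMap_mul
    (hmul : ∀ lam mu : Fin r → ℕ, ∀ a ∈ ℛ lam, ∀ b ∈ ℛ mu, a * b ∈ ⨆ nu ≤ lam + mu, ℛ nu)
    (hψmul : ∀ (lam mu : Fin r → ℕ) (a : ℛ lam) (b : ℛ mu) (c : ℛ (lam + mu)),
      ((a : R) * (b : R) - (c : R) ∈ ⨆ nu ∈ {nu : Fin r → ℕ | nu ≠ lam + mu}, ℛ nu) →
      ψ lam a * ψ mu b = ψ (lam + mu) c)
    {z w : MvPolynomial (Fin r) K ⊗[K] R} (hz : z ∈ Submodule.span K (reesGenerators ℛ))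
    (hw : w ∈ Submodule.span K (reesGenerators ℛ)) :
    symbolMap ℛ ψ (z * w) = symbolMap ℛ ψ z * symbolMap ℛ ψ w := by
  induction hz, hw using Submodule.span_induction₂ with
  | zero_left => simp
  | zero_right => simp
  | add_left x y z _ _ _ hx hy => rw [add_mul, map_add, map_add, hx, hy, add_mul]
  | add_right x y z _ _ _ hx hy => rw [mul_add, map_add, map_add, hx, hy, mul_add]
  | smul_left c x y _ _ h => rw [smul_mul_assoc, map_smul, map_smul, h, smul_mul_assoc]
  | smul_right c x y _ _ h => rw [mul_smul_comm, map_smul, map_smul, h, mul_smul_comm]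
  | mem_mem z w hz hw =>
    obtain ⟨lam, mu, hle, x, hx, rfl⟩ := hz
    obtain ⟨lam', mu', hle', y, hy, rfl⟩ := hw
    rw [Algebra.TensorProduct.tmul_mul_tmul, ← tpow_add]
    simp only [symbolMap_tmul]
    by_cases h : mu = lam ∧ mu' = lam'
    · obtain ⟨rfl, rfl⟩ := h
      rw [proj_of_mem ℛ hx, proj_of_mem ℛ hy]
      exact (hψmul _ _ ⟨x, hx⟩ ⟨y, hy⟩ _ (sub_proj_mem ℛ _ _)).symm
    · rw [proj_of_mem_iSup ℛ (hmul _ _ x hx y hy), map_zero]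
      · by_cases h1 : mu = lam
        · rw [proj_of_mem_ne ℛ hy fun e => h ⟨h1, e⟩, map_zero, mul_zero]
        · rw [proj_of_mem_ne ℛ hx h1, map_zero, zero_mul]
      · intro hge
        refine h ⟨funext fun i => ?_, funext fun i => ?_⟩ <;>
        · have h1 : mu i ≤ lam i := hle i
          have h2 : mu' i ≤ lam' i := hle' i
          have h3 : lam i + lam' i ≤ mu i + mu' i := hge i
          omega

lemma symbolMap_X_smul (i : Fin r) {z : MvPolynomial (Fin r) K ⊗[K] R}
    (hz : z ∈ Submodule.span K (reesGenerators ℛ)) :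
    symbolMap ℛ ψ ((X i : MvPolynomial (Fin r) K) • z) = 0 := by
  induction hz using Submodule.span_induction with
  | zero => simp
  | add x y _ _ hx hy => rw [smul_add, map_add, hx, hy, add_zero]
  | smul c x _ hx => rw [smul_comm, map_smul, hx, smul_zero]
  | mem z hz =>
    obtain ⟨lam, mu, hle, x, hx, rfl⟩ := hz
    rw [TensorProduct.smul_tmul', smul_eq_mul, ← tpow_single, ← tpow_add, symbolMap_tmul,
      proj_of_mem_ne ℛ hx, map_zero]
    rintro rfl
    simpa using hle i

end Projection

/-- The linear map `⊕ R_λ → K[t] ⊗ R`, `x ∈ R_λ ↦ t^λ ⊗ x`. -/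
noncomputable def topMap (ℛ : (Fin r → ℕ) → Submodule K R) :
    (DirectSum (Fin r → ℕ) fun lam => ℛ lam) →ₗ[K] MvPolynomial (Fin r) K ⊗[K] R :=
  DirectSum.toModule K _ _ fun lam =>
    TensorProduct.mk K (MvPolynomial (Fin r) K) R (tpow K lam) ∘ₗ (ℛ lam).subtype

lemma topMap_lof (ℛ : (Fin r → ℕ) → Submodule K R) (lam : Fin r → ℕ) (x : ℛ lam) :
    topMap ℛ (DirectSum.lof K _ (fun mu => ℛ mu) lam x) = tpow K lam ⊗ₜ (x : R) := by
  simp [topMap]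

lemma topMap_mem (ℛ : (Fin r → ℕ) → Submodule K R) (g : DirectSum (Fin r → ℕ) fun lam => ℛ lam) :
    topMap ℛ g ∈ Submodule.span K (reesGenerators ℛ) := by
  induction g using DirectSum.induction_on with
  | zero => simp
  | of lam x =>
    rw [← DirectSum.lof_eq_of K, topMap_lof]
    exact Submodule.subset_span ⟨lam, lam, le_rfl, x, x.2, rfl⟩
  | add x y hx hy => rw [map_add]; exact add_mem hx hy

lemma symbolMap_topMap (ℛ : (Fin r → ℕ) → Submodule K R) [DirectSum.Decomposition ℛ]
    {S : Type*} [CommRing S] [Algebra K S] (ψ : ∀ lam, ℛ lam →ₗ[K] S)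
    (g : DirectSum (Fin r → ℕ) fun lam => ℛ lam) :
    symbolMap ℛ ψ (topMap ℛ g) = DirectSum.toModule K _ S ψ g := by
  induction g using DirectSum.induction_on with
  | zero => simp
  | of lam x =>
    rw [← DirectSum.lof_eq_of K, topMap_lof, symbolMap_tmul, proj_of_mem ℛ x.2,
      DirectSum.toModule_lof]
  | add x y hx hy => rw [map_add, map_add, map_add, hx, hy]

/-- If every `ψ_λ` is injective and the target is the internal direct sum of their ranges, then
the induced map from the external direct sum is bijective. -/
lemma bijective_toModule {ι : Type*} [DecidableEq ι] {M : ι → Type*} [∀ i, AddCommGroup (M i)]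
    [∀ i, Module K (M i)] {N : Type*} [AddCommGroup N] [Module K N] (ψ : ∀ i, M i →ₗ[K] N)
    (hinj : ∀ i, Function.Injective (ψ i))
    (hdirect : DirectSum.IsInternal fun i => LinearMap.range (ψ i)) :
    Function.Bijective (DirectSum.toModule K ι N ψ) := by
  have h : ⇑(DirectSum.toModule K ι N ψ) =
      ⇑(DirectSum.coeLinearMap fun i => LinearMap.range (ψ i)) ∘
        ⇑(DFinsupp.mapRange.linearEquiv fun i => LinearEquiv.ofInjective (ψ i) (hinj i)) := by
    rw [← LinearEquiv.coe_coe, ← LinearMap.coe_comp]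
    congr 1
    refine DirectSum.linearMap_ext K fun i => LinearMap.ext fun x => ?_
    have hx : DFinsupp.mapRange.linearEquiv (fun i => LinearEquiv.ofInjective (ψ i) (hinj i))
        (DirectSum.lof K ι M i x) = DirectSum.lof K ι (fun i => LinearMap.range (ψ i)) i
          (LinearEquiv.ofInjective (ψ i) (hinj i) x) :=
      DFinsupp.mapRange_single (hf := fun _ => map_zero _)
    rw [LinearMap.comp_apply, LinearMap.comp_apply, LinearMap.comp_apply, DirectSum.toModule_lof,
      LinearEquiv.coe_coe, hx, DirectSum.coeLinearMap_lof, LinearEquiv.ofInjective_apply]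
  rw [h]
  exact Function.Bijective.comp hdirect (LinearEquiv.bijective _)

/-- Modulo `𝔪₀`, every element of the Rees-type algebra is a sum of terms `t^λ ⊗ x_λ` with
`x_λ ∈ R_λ`. -/
lemma exists_topMap_add (ℛ : (Fin r → ℕ) → Submodule K R)
    (A : Subalgebra (MvPolynomial (Fin r) K) (MvPolynomial (Fin r) K ⊗[K] R))
    (hA : (Subalgebra.toSubmodule A).restrictScalars K = Submodule.span K (reesGenerators ℛ))
    {z : MvPolynomial (Fin r) K ⊗[K] R} (hz : z ∈ Submodule.span K (reesGenerators ℛ)) :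
    ∃ g, ∃ y ∈ Ideal.map (algebraMap (MvPolynomial (Fin r) K) A)
      (Ideal.span (Set.range (X : Fin r → MvPolynomial (Fin r) K))),
      z = topMap ℛ g + y := by
  induction hz using Submodule.span_induction with
  | zero => exact ⟨0, 0, zero_mem _, by simp⟩
  | add _ _ _ _ hz hw =>
    obtain ⟨g, y, hy, rfl⟩ := hz
    obtain ⟨g', y', hy', rfl⟩ := hw
    refine ⟨g + g', y + y', add_mem hy hy', ?_⟩
    rw [map_add, Subalgebra.coe_add, add_add_add_comm]
  | smul c _ _ hx =>
    obtain ⟨g, y, hy, rfl⟩ := hx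
    refine ⟨c • g, c • y, Submodule.smul_of_tower_mem _ c hy, ?_⟩
    rw [map_smul, smul_add]
    rfl
  | mem z hz =>
    obtain ⟨lam, mu, hle, x, hx, rfl⟩ := hz
    by_cases h : mu = lam
    · subst h
      exact ⟨DirectSum.lof K _ (fun mu => ℛ mu) mu ⟨x, hx⟩, 0, zero_mem _, by simp [topMap_lof]⟩
    · have hmem : tpow K mu ⊗ₜ[K] x ∈ A := by
        have : tpow K mu ⊗ₜ[K] x ∈ (Subalgebra.toSubmodule A).restrictScalars K :=
          hA ▸ Submodule.subset_span ⟨mu, mu, le_rfl, x, hx, rfl⟩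
        exact this
      refine ⟨0, algebraMap _ A (tpow K (lam - mu)) * ⟨_, hmem⟩, Ideal.mul_mem_right _ _
        (Ideal.mem_map_of_mem _ (tpow_mem_span_X fun h0 => h (le_antisymm hle
          (tsub_eq_zero_iff_le.mp h0)))), ?_⟩
      rw [map_zero, zero_add, ← Algebra.smul_def, Subalgebra.coe_smul, TensorProduct.smul_tmul',
        smul_eq_mul, ← tpow_add, tsub_add_cancel_of_le hle]

end MultiFiltered

/-- Let `(R_λ)_{λ∈ℕ^r}` be a multi-filtered decomposition of a commutative
`K`-algebra `R`, and let `A = \tilde R = Σ_λ t^λ ⊗ R_{≤λ}` be the corresponding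
`K[t]`-subalgebra of `K[t_1,…,t_r] ⊗_K R`.  Let `S` (together with the maps `ψ_λ`) be the
associated graded algebra `gr R` (underlying space `⊕_λ R_λ`, product
`(a,b) ↦ π_{λ+μ}(ab)`, where the condition "`c = π_{λ+μ}(ab)`" is expressed by
`ab - c ∈ Σ_{ν ≠ λ+μ} R_ν`).  Then `\tilde R / 𝔪_0 \tilde R ≅ gr R` as `K`-algebras,
where `𝔪_0 = (t_1,…,t_r) ⊆ K[t]`; equivalently (first isomorphism theorem), there is a
surjective `K`-algebra homomorphism `\tilde R → gr R` with kernel `𝔪_0 \tilde R`. -/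
theorem deformation_special_fiber_eq_gr
    {K : Type*} [Field K] {r : ℕ} (hr : 1 ≤ r)
    {R : Type*} [CommRing R] [Algebra K R]
    (ℛ : (Fin r → ℕ) → Submodule K R)
    (hdirect : DirectSum.IsInternal ℛ)
    (hone : (1 : R) ∈ ℛ 0)
    (hmul : ∀ lam mu : Fin r → ℕ, ∀ a ∈ ℛ lam, ∀ b ∈ ℛ mu,
      a * b ∈ ⨆ nu ≤ lam + mu, ℛ nu)
    -- `A` is the subalgebra `\tilde R = Σ_λ t^λ ⊗ R_{≤λ}` of `K[t] ⊗_K R`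
    (A : Subalgebra (MvPolynomial (Fin r) K) (MvPolynomial (Fin r) K ⊗[K] R))
    (hA : (Subalgebra.toSubmodule A).restrictScalars K =
        (⨆ lam : Fin r → ℕ,
          Submodule.map
            (TensorProduct.mk K (MvPolynomial (Fin r) K) R
              (∏ i, MvPolynomial.X i ^ lam i))
            (⨆ mu ≤ lam, ℛ mu)))
    -- `S`, together with the maps `ψ_λ`, is the associated graded algebra `gr R`
    {S : Type*} [CommRing S] [Algebra K S]
    (ψ : ∀ lam, ℛ lam →ₗ[K] S)
    (hψinj : ∀ lam, Function.Injective (ψ lam))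
    (hψdirect : DirectSum.IsInternal fun lam => LinearMap.range (ψ lam))
    (hψone : ψ 0 ⟨1, hone⟩ = 1)
    (hψmul : ∀ (lam mu : Fin r → ℕ) (a : ℛ lam) (b : ℛ mu) (c : ℛ (lam + mu)),
      ((a : R) * (b : R) - (c : R) ∈ ⨆ nu ∈ {nu : Fin r → ℕ | nu ≠ lam + mu}, ℛ nu) →
      ψ lam a * ψ mu b = ψ (lam + mu) c) :
    ∃ Φ : A →ₐ[K] S, Function.Surjective Φ ∧
      RingHom.ker (Φ : A →+* S) =
        Ideal.map (algebraMap (MvPolynomial (Fin r) K) A)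
          (Ideal.span (Set.range (MvPolynomial.X : Fin r → MvPolynomial (Fin r) K))) := by
  classical
  open MultiFiltered in
  let _ : DirectSum.Decomposition ℛ := hdirect.chooseDecomposition
  rw [iSup_map_eq_span_reesGenerators] at hA
  have mem_span (a : A) : (a : MvPolynomial (Fin r) K ⊗[K] R) ∈
      Submodule.span K (reesGenerators ℛ) := by
    rw [← hA]
    exact a.2
  have mem_A {z} (hz : z ∈ Submodule.span K (reesGenerators ℛ)) : z ∈ A := by
    rw [← hA] at hz
    exact hz
  have hbij := bijective_toModule ψ hψinj hψdirect
  let Φ : A →ₐ[K] S := AlgHom.ofLinearMap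
    (symbolMap ℛ ψ ∘ₗ (A.val.restrictScalars K).toLinearMap)
    (by
      change symbolMap ℛ ψ (1 ⊗ₜ 1) = 1
      rw [← tpow_zero, symbolMap_tmul, proj_of_mem ℛ hone, hψone])
    (fun a b => symbolMap_mul ℛ ψ hmul hψmul (mem_span a) (mem_span b))
  have hΦ (a : A) : Φ a = symbolMap ℛ ψ a := rfl
  have hle : Ideal.map (algebraMap (MvPolynomial (Fin r) K) A)
      (Ideal.span (Set.range (MvPolynomial.X : Fin r → MvPolynomial (Fin r) K))) ≤
      RingHom.ker (Φ : A →+* S) := by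
    rw [Ideal.map_span, Ideal.span_le]
    rintro _ ⟨_, ⟨i, rfl⟩, rfl⟩
    have h := symbolMap_X_smul ℛ ψ i (mem_span 1)
    rw [← Subalgebra.coe_smul, ← hΦ, Algebra.smul_def, mul_one] at h
    exact h
  refine ⟨Φ, fun s => ?_, le_antisymm (fun a ha => ?_) hle⟩
  · obtain ⟨g, rfl⟩ := hbij.2 s
    exact ⟨⟨topMap ℛ g, mem_A (topMap_mem ℛ g)⟩, symbolMap_topMap ℛ ψ g⟩
  · obtain ⟨g, y, hy, hay⟩ := exists_topMap_add ℛ A hA (mem_span a)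
    have hy0 : symbolMap ℛ ψ y = 0 := hle hy
    have ha0 : symbolMap ℛ ψ a = 0 := ha
    rw [hay, map_add, hy0, add_zero, symbolMap_topMap] at ha0
    rw [(map_eq_zero_iff _ hbij.1).mp ha0, map_zero, zero_add] at hay
    rwa [Subtype.ext hay]
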